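/- Fix g > 1, ω > 1, γ ≥ 1, η ∈ (0,1). Define for μ > 1: I_AB(μ) := (1/2)·log₂( μ / ( μ − gη(μ²−1)/V_B(μ) ) ) with V_B(μ) = η(gμ+(g−1)ω)+(1−η)γ; and χ_BE(μ) := S_T(μ) − S_C(μ), where S_T(μ) is the sum of h over the symplectic eigenvalues of [[((g−1)μ+gω)I, √(g(ω²−1))Z],[√(g(ω²−1))Z, ωI]] and S_C(μ) is the sum of h over the symplectic eigenvalues of V_{E′e}(μ) − (1/V_B(μ))·w(μ)w(μ)ᵀ, w(μ) = (√(g(g−1)η)(μ+ω), 0, √((g−1)η(ω²−1)), 0)ᵀ. Then I_AB(μ) − χ_BE(μ) converges as μ → ∞ to R◀(g,ω,η,γ) := (1/2)·log₂( [η·ω + γ·(g−1)·(1−η)] / ( (g−1)·[γ·(1−η) + η·ω·(g−1)] ) ) + h( √( ω·[η + γ·ω·(g−1)·(1−η)] / (η·ω + γ·(g−1)·(1−η)) ) ) − h(ω). -/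

import Mathlib

open Real Filter Matrix Polynomial

/-- The standard two-mode symplectic form `Ω₂`. -/
noncomputable def Omega2 : Matrix (Fin 4) (Fin 4) ℝ :=
  !![0, 1, 0, 0; -1, 0, 0, 0; 0, 0, 0, 1; 0, 0, -1, 0]

/-- Eve's total covariance matrix
`V_{E′e}(μ) = [[((g−1)μ+gω)I, √(g(ω²−1))Z],[√(g(ω²−1))Z, ωI]]`. -/
noncomputable def VEe (g ω μ : ℝ) : Matrix (Fin 4) (Fin 4) ℝ :=
  !![(g - 1) * μ + g * ω, 0, Real.sqrt (g * (ω ^ 2 - 1)), 0;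
     0, (g - 1) * μ + g * ω, 0, -Real.sqrt (g * (ω ^ 2 - 1));
     Real.sqrt (g * (ω ^ 2 - 1)), 0, ω, 0;
     0, -Real.sqrt (g * (ω ^ 2 - 1)), 0, ω]

/-- Bob's detected variance `V_B(μ) = η(gμ+(g−1)ω)+(1−η)γ`. -/
noncomputable def VB (g ω γ η μ : ℝ) : ℝ :=
  η * (g * μ + (g - 1) * ω) + (1 - η) * γ

/-- The RR conditioning vector `w(μ) = (√(g(g−1)η)(μ+ω), 0, √((g−1)η(ω²−1)), 0)ᵀ`. -/
noncomputable def wRR (g ω η μ : ℝ) : Fin 4 → ℝ :=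
  ![Real.sqrt (g * (g - 1) * η) * (μ + ω), 0, Real.sqrt ((g - 1) * η * (ω ^ 2 - 1)), 0]

/-- Eve's conditional covariance matrix after Bob's `q`-homodyne:
`M(μ) = V_{E′e}(μ) − (1/V_B(μ))·w(μ)w(μ)ᵀ`. -/
noncomputable def Mrr (g ω γ η μ : ℝ) : Matrix (Fin 4) (Fin 4) ℝ :=
  VEe g ω μ - (VB g ω γ η μ)⁻¹ • Matrix.vecMulVec (wRR g ω η μ) (wRR g ω η μ)

/-- The bosonic entropy function. -/
noncomputable def h (x : ℝ) : ℝ :=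
  ((x + 1) / 2) * Real.logb 2 ((x + 1) / 2) - ((x - 1) / 2) * Real.logb 2 ((x - 1) / 2)

/-- `Δ(μ)` for Eve's total covariance matrix `V_{E′e}(μ)`. -/
noncomputable def Delta (g ω μ : ℝ) : ℝ :=
  ((g - 1) * μ + g * ω) ^ 2 + ω ^ 2 - 2 * (g * (ω ^ 2 - 1))

/-- `D(μ)` for Eve's total covariance matrix `V_{E′e}(μ)`. -/
noncomputable def Dprod (g ω μ : ℝ) : ℝ :=
  (((g - 1) * μ + g * ω) * ω - g * (ω ^ 2 - 1)) ^ 2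

/-- The larger symplectic eigenvalue of `V_{E′e}(μ)`. -/
noncomputable def nu1 (g ω μ : ℝ) : ℝ :=
  Real.sqrt ((Delta g ω μ + Real.sqrt ((Delta g ω μ) ^ 2 - 4 * Dprod g ω μ)) / 2)

/-- The smaller symplectic eigenvalue of `V_{E′e}(μ)`. -/
noncomputable def nu2 (g ω μ : ℝ) : ℝ :=
  Real.sqrt ((Delta g ω μ - Real.sqrt ((Delta g ω μ) ^ 2 - 4 * Dprod g ω μ)) / 2)


/-- The closed-form RR rate `R◀(g, ω, η, γ)` of Theorem 2 (with the conditional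
eigenvalue `ν̄₂∞` consistent with the derivation). -/
noncomputable def Rrr (g ω η γ : ℝ) : ℝ :=
  (1 / 2) * Real.logb 2
      ((η * ω + γ * (g - 1) * (1 - η)) /
        ((g - 1) * (γ * (1 - η) + η * ω * (g - 1))))
    + h (Real.sqrt (ω * (η + γ * ω * (g - 1) * (1 - η)) /
        (η * ω + γ * (g - 1) * (1 - η))))
    - h ω

/-- Limits at infinity through the substitution `t = 1/μ`. -/
lemma tendsto_of_inv (f F : ℝ → ℝ) (L : ℝ) (hF : ContinuousAt F 0) (h0 : F 0 = L)
    (hf : ∀ μ : ℝ, 1 < μ → F μ⁻¹ = f μ) : Tendsto f atTop (nhds L) := by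
  have h1 : Tendsto (fun μ : ℝ => F μ⁻¹) atTop (nhds L) := by
    rw [← h0]
    exact hF.tendsto.comp tendsto_inv_atTop_zero
  refine h1.congr' ?_
  filter_upwards [eventually_gt_atTop 1] with μ hμ using hf μ hμ

lemma h_continuous : Continuous h := by
  have h1 : ∀ x : ℝ, h x = (((x + 1) / 2) * Real.log ((x + 1) / 2)
      - ((x - 1) / 2) * Real.log ((x - 1) / 2)) / Real.log 2 := by
    intro x
    simp only [h, Real.logb]
    ring
  have h2 : h = fun x : ℝ => (((x + 1) / 2) * Real.log ((x + 1) / 2)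
      - ((x - 1) / 2) * Real.log ((x - 1) / 2)) / Real.log 2 := funext h1
  rw [h2]
  have a1 : Continuous fun x : ℝ => ((x + 1) / 2) * Real.log ((x + 1) / 2) :=
    Real.continuous_mul_log.comp (by fun_prop)
  have a2 : Continuous fun x : ℝ => ((x - 1) / 2) * Real.log ((x - 1) / 2) :=
    Real.continuous_mul_log.comp (by fun_prop)
  exact (a1.sub a2).div_const _

/-- `h x - log₂ x` has a limit at infinity. -/
lemma h_asymp : Tendsto (fun x : ℝ => h x - Real.logb 2 x) atTop
    (nhds ((1 - Real.log 2) / Real.log 2)) := by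
  have p1 := Real.tendsto_mul_log_one_add_div_atTop 1
  have p2 := Real.tendsto_mul_log_one_add_div_atTop (-1)
  have l1 : Tendsto (fun x : ℝ => Real.log (1 + 1 / x)) atTop (nhds 0) := by
    refine tendsto_of_inv _ (fun t => Real.log (1 + t)) _ ?_ (by simp) ?_
    · exact ContinuousAt.log (by fun_prop) (by norm_num)
    · intro μ _; simp
  have l2 : Tendsto (fun x : ℝ => Real.log (1 + (-1) / x)) atTop (nhds 0) := by
    refine tendsto_of_inv _ (fun t => Real.log (1 - t)) _ ?_ (by simp) ?_
    · exact ContinuousAt.log (by fun_prop) (by norm_num)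
    · intro μ _; simp [neg_div, sub_eq_add_neg]
  have key := ((((p1.add l1).sub (p2.sub l2)).div_const 2).sub_const (Real.log 2)).div_const
    (Real.log 2)
  have e : (((1 : ℝ) + 0 - (-1 - 0)) / 2 - Real.log 2) / Real.log 2
      = (1 - Real.log 2) / Real.log 2 := by norm_num
  rw [e] at key
  refine key.congr' ?_
  filter_upwards [eventually_gt_atTop 1] with x hx
  have hx0 : x ≠ 0 := by positivity
  have e1 : Real.log ((x + 1) / 2) = Real.log x + Real.log (1 + 1 / x) - Real.log 2 := by
    have : 1 + 1 / x ≠ 0 := by positivity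
    rw [← Real.log_mul hx0 this, ← Real.log_div (mul_ne_zero hx0 this) two_ne_zero]
    congr 1
    field_simp
  have e2 : Real.log ((x - 1) / 2) = Real.log x + Real.log (1 + (-1) / x) - Real.log 2 := by
    have : 1 + (-1) / x ≠ 0 := by
      have : 1 + (-1) / x = (x - 1) / x := by field_simp; ring
      rw [this]
      exact div_ne_zero (by linarith) hx0
    rw [← Real.log_mul hx0 this, ← Real.log_div (mul_ne_zero hx0 this) two_ne_zero]
    congr 1
    field_simp
    ring
  have hl : Real.log 2 ≠ 0 := (Real.log_pos one_lt_two).ne'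
  simp only [h, Real.logb]
  rw [e1, e2]
  field_simp
  ring

/-- Asymptotics of the two roots of the symplectic characteristic equation. -/
lemma roots_asymp (Δ D f : ℝ → ℝ) (d e : ℝ) (hd : 0 < d) (hf : Tendsto f atTop atTop)
    (hΔ : Tendsto (fun μ => Δ μ / f μ) atTop (nhds d))
    (hD : Tendsto (fun μ => D μ / f μ) atTop (nhds e)) :
    Tendsto (fun μ => h (√((Δ μ + √((Δ μ) ^ 2 - 4 * D μ)) / 2)) - (1 / 2) * Real.logb 2 (f μ))
      atTop (nhds ((1 - Real.log 2) / Real.log 2 + (1 / 2) * Real.logb 2 d)) ∧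
    Tendsto (fun μ => h (√((Δ μ - √((Δ μ) ^ 2 - 4 * D μ)) / 2))) atTop (nhds (h (√(e / d)))) := by
  have hinv : Tendsto (fun μ => (f μ)⁻¹) atTop (nhds 0) := tendsto_inv_atTop_zero.comp hf
  have hdisc : Tendsto (fun μ => (Δ μ / f μ) ^ 2 - 4 * (D μ / f μ * (f μ)⁻¹)) atTop
      (nhds (d ^ 2)) := by
    have := (hΔ.pow 2).sub ((hD.mul hinv).const_mul 4)
    simpa using this
  have fpos : ∀ᶠ μ in atTop, 0 < f μ := hf.eventually_gt_atTop 0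
  have hs : Tendsto (fun μ => √((Δ μ) ^ 2 - 4 * D μ) / f μ) atTop (nhds d) := by
    have h1 := hdisc.sqrt
    rw [Real.sqrt_sq hd.le] at h1
    refine h1.congr' ?_
    filter_upwards [fpos] with μ hμ
    rw [show (Δ μ / f μ) ^ 2 - 4 * (D μ / f μ * (f μ)⁻¹) = ((Δ μ) ^ 2 - 4 * D μ) / (f μ) ^ 2 by
      field_simp]
    rw [Real.sqrt_div' _ (sq_nonneg _), Real.sqrt_sq hμ.le]
  have hdpos : ∀ᶠ μ in atTop, 0 ≤ (Δ μ) ^ 2 - 4 * D μ := by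
    filter_upwards [fpos, hdisc.eventually_const_lt (show 0 < d ^ 2 by positivity)] with μ hμ h2
    rw [show (Δ μ / f μ) ^ 2 - 4 * (D μ / f μ * (f μ)⁻¹) = ((Δ μ) ^ 2 - 4 * D μ) / (f μ) ^ 2 by
      field_simp] at h2
    have := (div_pos_iff_of_pos_right (show 0 < (f μ) ^ 2 by positivity)).1 h2
    exact this.le
  have hsum : Tendsto (fun μ => (Δ μ + √((Δ μ) ^ 2 - 4 * D μ)) / 2 / f μ) atTop (nhds d) := by
    have h1 := (hΔ.add hs).div_const 2
    rw [show (d + d) / 2 = d by ring] at h1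
    refine h1.congr fun μ => ?_
    ring
  have hsumpos := hsum.eventually_const_lt hd
  constructor
  · have hbig : Tendsto (fun μ => (Δ μ + √((Δ μ) ^ 2 - 4 * D μ)) / 2) atTop atTop := by
      refine (hsum.pos_mul_atTop hd hf).congr' ?_
      filter_upwards [fpos] with μ hμ
      field_simp
    have h1 := h_asymp.comp (Real.tendsto_sqrt_atTop.comp hbig)
    have h2 : Tendsto (fun μ => Real.logb 2 ((Δ μ + √((Δ μ) ^ 2 - 4 * D μ)) / 2 / f μ)) atTop
        (nhds (Real.logb 2 d)) := by
      simp only [Real.logb]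
      exact (hsum.log hd.ne').div_const _
    refine (h1.add (h2.const_mul (1 / 2))).congr' ?_
    filter_upwards [fpos, hbig.eventually_gt_atTop 0] with μ hμ h3
    simp only [Function.comp]
    rw [Real.logb_div h3.ne' hμ.ne']
    simp only [Real.logb]
    rw [Real.log_sqrt h3.le]
    ring
  · have h1 : Tendsto (fun μ => (D μ / f μ) / ((Δ μ + √((Δ μ) ^ 2 - 4 * D μ)) / 2 / f μ)) atTop
        (nhds (e / d)) := hD.div hsum hd.ne'
    refine (h_continuous.tendsto _).comp ((h1.congr' ?_).sqrt)
    filter_upwards [fpos, hdpos, hsumpos] with μ hμ h2 h3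
    have h4 : 0 < (Δ μ + √((Δ μ) ^ 2 - 4 * D μ)) / 2 :=
      (div_pos_iff_of_pos_right hμ).1 h3
    rw [div_div_div_cancel_right₀ hμ.ne', div_eq_iff h4.ne']
    nlinarith [Real.sq_sqrt h2]

lemma charpoly_coeffs (p q r a b c Δ D : ℝ)
    (hc : Matrix.charpoly (Omega2 * !![p, 0, q, 0; 0, a, 0, -c; q, 0, r, 0; 0, -c, 0, b]) =
        X ^ 4 + C Δ * X ^ 2 + C D) :
    Δ = p * a - 2 * q * c + r * b ∧ D = (p * r - q ^ 2) * (a * b - c ^ 2) := by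
  have e0 := congrArg (Polynomial.eval 0) hc
  have e1 := congrArg (Polynomial.eval 1) hc
  have hM : ∀ t : ℝ, Matrix.scalar (Fin 4) t
      - Omega2 * !![p, 0, q, 0; 0, a, 0, -c; q, 0, r, 0; 0, -c, 0, b]
      = !![t, -a, 0, c; p, t, q, 0; 0, c, t, -b; q, 0, r, t] := by
    intro t
    ext i j
    fin_cases i <;> fin_cases j <;>
      simp [Omega2]
  rw [Matrix.eval_charpoly, hM] at e0 e1
  simp [Matrix.det_succ_row_zero, Fin.sum_univ_succ, Fin.succAbove] at e0 e1
  constructor <;> linarith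

lemma Mrr_eq (g ω γ η μ : ℝ) (hg : 1 < g) (hω : 1 < ω) (hη : 0 < η) :
    Mrr g ω γ η μ =
      !![(g - 1) * μ + g * ω - g * (g - 1) * η * (μ + ω) ^ 2 / VB g ω γ η μ, 0,
          √(g * (ω ^ 2 - 1)) * (1 - (g - 1) * η * (μ + ω) / VB g ω γ η μ), 0;
        0, (g - 1) * μ + g * ω, 0, -√(g * (ω ^ 2 - 1));
        √(g * (ω ^ 2 - 1)) * (1 - (g - 1) * η * (μ + ω) / VB g ω γ η μ), 0,
          ω - (g - 1) * η * (ω ^ 2 - 1) / VB g ω γ η μ, 0;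
        0, -√(g * (ω ^ 2 - 1)), 0, ω] := by
  have hg' : 0 < g - 1 := by linarith
  have hω' : 0 < ω ^ 2 - 1 := by nlinarith
  have s1 : √(g * (g - 1) * η) * √(g * (g - 1) * η) = g * (g - 1) * η :=
    Real.mul_self_sqrt (by positivity)
  have s3 : √((g - 1) * η * (ω ^ 2 - 1)) * √((g - 1) * η * (ω ^ 2 - 1))
      = (g - 1) * η * (ω ^ 2 - 1) := Real.mul_self_sqrt (by positivity)
  have s2 : √(g * (g - 1) * η) * √((g - 1) * η * (ω ^ 2 - 1))
      = (g - 1) * η * √(g * (ω ^ 2 - 1)) := by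
    rw [← Real.sqrt_mul (by positivity),
      show g * (g - 1) * η * ((g - 1) * η * (ω ^ 2 - 1))
        = ((g - 1) * η) ^ 2 * (g * (ω ^ 2 - 1)) by ring,
      Real.sqrt_mul (by positivity), Real.sqrt_sq (by positivity)]
  generalize hu : √(g * (g - 1) * η) = u at *
  generalize hv : √((g - 1) * η * (ω ^ 2 - 1)) = v at *
  ext i j
  fin_cases i <;> fin_cases j <;>
    simp [Mrr, VEe, wRR, hu, hv]
  · linear_combination (VB g ω γ η μ)⁻¹ * (μ + ω) ^ 2 * s1
  · linear_combination -(VB g ω γ η μ)⁻¹ * (μ + ω) * s2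
  · linear_combination -(VB g ω γ η μ)⁻¹ * (μ + ω) * s2
  · linear_combination (VB g ω γ η μ)⁻¹ * s3

/-- Theorem 2 (RR): the finite-modulation key rate `I_AB(μ) − χ_BE(μ)` converges to
the closed form `R◀(g, ω, η, γ)` as `μ → ∞`. -/
theorem key_rate_limit_RR (g ω γ η : ℝ)
    (hg : 1 < g) (hω : 1 < ω) (hγ : 1 ≤ γ) (hη : η ∈ Set.Ioo (0 : ℝ) 1)
    (Δb Db : ℝ → ℝ)
    (hchar : ∀ μ : ℝ, 1 < μ →
      Matrix.charpoly (Omega2 * Mrr g ω γ η μ) =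
        X ^ 4 + C (Δb μ) * X ^ 2 + C (Db μ)) :
    Filter.Tendsto
      (fun μ : ℝ =>
        (1 / 2) * Real.logb 2
            (μ / (μ - g * η * (μ ^ 2 - 1) / VB g ω γ η μ))
          - ((h (nu1 g ω μ) + h (nu2 g ω μ))
              - (h (Real.sqrt ((Δb μ + Real.sqrt ((Δb μ) ^ 2 - 4 * Db μ)) / 2))
                + h (Real.sqrt ((Δb μ - Real.sqrt ((Δb μ) ^ 2 - 4 * Db μ)) / 2)))))
      Filter.atTop (nhds (Rrr g ω η γ)) := by
  obtain ⟨hη0, hη1⟩ := hη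
  have hg' : 0 < g - 1 := by linarith
  have hη' : 0 < 1 - η := by linarith
  have hω' : 0 < ω ^ 2 - 1 := by nlinarith
  have hg0 : 0 < g := by linarith
  have hω0 : 0 < ω := by linarith
  have hγ0 : 0 < γ := by linarith
  set k : ℝ := η * (g - 1) * ω + (1 - η) * γ with hk
  set A : ℝ := η * ω + γ * (g - 1) * (1 - η) with hA
  have kpos : 0 < k := by positivity
  have Apos : 0 < A := by positivity
  have hVB : ∀ μ, VB g ω γ η μ = η * g * μ + k := by
    intro μ; simp only [VB, hk]; ring
  set c : ℝ := √(g * (ω ^ 2 - 1)) with hc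
  have c2 : c ^ 2 = g * (ω ^ 2 - 1) := Real.sq_sqrt (by positivity)
  have hηg : 0 < η * g := by positivity
  have cont : ∀ a b : ℝ, ContinuousAt (fun t : ℝ => (a + b * t) / (η * g + k * t)) 0 := by
    intro a b
    refine ContinuousAt.div (by fun_prop) (by fun_prop) ?_
    simpa using ⟨hη0.ne', hg0.ne'⟩
  have lp : Tendsto (fun μ => (g - 1) * μ + g * ω
      - g * (g - 1) * η * (μ + ω) ^ 2 / VB g ω γ η μ) atTop (nhds (A / (η * g))) := by
    refine tendsto_of_inv _ _ _ (cont A (g * ω * k - g * (g - 1) * η * ω ^ 2)) (by simp) ?_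
    intro μ hμ
    have : 0 < η * g * μ + k := by positivity
    rw [hVB]
    field_simp
    simp only [hA, hk]
    ring
  have lq : Tendsto (fun μ => c * (1 - (g - 1) * η * (μ + ω) / VB g ω γ η μ)) atTop
      (nhds (c / g)) := by
    refine tendsto_of_inv _ _ _ (cont (c * η) (c * (k - (g - 1) * η * ω))) ?_ ?_
    · simp; field_simp
    intro μ hμ
    have : 0 < η * g * μ + k := by positivity
    rw [hVB]
    field_simp
    ring
  have lr : Tendsto (fun μ => ω - (g - 1) * η * (ω ^ 2 - 1) / VB g ω γ η μ) atTop
      (nhds ω) := by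
    refine tendsto_of_inv _ _ _ (cont (ω * η * g) (ω * k - (g - 1) * η * (ω ^ 2 - 1))) ?_ ?_
    · simp; field_simp
    intro μ hμ
    have : 0 < η * g * μ + k := by positivity
    rw [hVB]
    field_simp
    ring
  have la : Tendsto (fun μ => ((g - 1) * μ + g * ω) / μ) atTop (nhds (g - 1)) := by
    refine tendsto_of_inv _ (fun t => (g - 1) + g * ω * t) _ (by fun_prop) (by simp) ?_
    intro μ hμ
    field_simp
  have li : Tendsto (fun μ : ℝ => μ⁻¹) atTop (nhds 0) := tendsto_inv_atTop_zero
  have coeffs : ∀ μ : ℝ, 1 < μ → _ := fun μ hμ =>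
    charpoly_coeffs _ _ _ _ _ _ _ _ (Mrr_eq g ω γ η μ hg hω hη0 ▸ hchar μ hμ)
  have lΔb : Tendsto (fun μ => Δb μ / μ) atTop (nhds (A / (η * g) * (g - 1))) := by
    have h1 := ((lp.mul la).sub ((lq.mul_const (2 * c)).mul li)).add ((lr.mul_const ω).mul li)
    simp only [mul_zero, sub_zero, add_zero] at h1
    refine h1.congr' ?_
    filter_upwards [eventually_gt_atTop 1] with μ hμ
    rw [(coeffs μ hμ).1]
    ring
  have lDb : Tendsto (fun μ => Db μ / μ) atTop
      (nhds ((A / (η * g) * ω - (c / g) ^ 2) * ((g - 1) * ω))) := by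
    have h1 := ((lp.mul lr).sub (lq.pow 2)).mul ((la.mul_const ω).sub (li.const_mul (c ^ 2)))
    simp only [mul_zero, sub_zero] at h1
    refine h1.congr' ?_
    filter_upwards [eventually_gt_atTop 1] with μ hμ
    rw [(coeffs μ hμ).2]
    ring
  have lΔ : Tendsto (fun μ => Delta g ω μ / μ ^ 2) atTop (nhds ((g - 1) ^ 2)) := by
    refine tendsto_of_inv _ (fun t => ((g - 1) + g * ω * t) ^ 2
      + (ω ^ 2 - 2 * (g * (ω ^ 2 - 1))) * t ^ 2) _ (by fun_prop) (by simp) ?_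
    intro μ hμ
    simp only [Delta]
    field_simp
    ring
  have lD : Tendsto (fun μ => Dprod g ω μ / μ ^ 2) atTop (nhds (((g - 1) * ω) ^ 2)) := by
    refine tendsto_of_inv _ (fun t => (((g - 1) + g * ω * t) * ω
      - g * (ω ^ 2 - 1) * t) ^ 2) _ (by fun_prop) (by simp) ?_
    intro μ hμ
    simp only [Dprod]
    field_simp
  obtain ⟨t1, t2⟩ := roots_asymp _ _ (fun μ => μ ^ 2) _ _ (by positivity)
    (tendsto_pow_atTop two_ne_zero) lΔ lD
  obtain ⟨b1, b2⟩ := roots_asymp _ _ (fun μ => μ) _ _ (by positivity) tendsto_id lΔb lDb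
  have lI : Tendsto (fun μ => μ / (μ - g * η * (μ ^ 2 - 1) / VB g ω γ η μ) / μ) atTop
      (nhds (η * g / k)) := by
    refine tendsto_of_inv _ (fun t => (η * g + k * t) / (k + g * η * t)) _ ?_ (by simp) ?_
    · refine ContinuousAt.div (by fun_prop) (by fun_prop) ?_
      simpa using kpos.ne'
    intro μ hμ
    have h1 : 0 < η * g * μ + k := by positivity
    rw [hVB]
    have h2 : μ - g * η * (μ ^ 2 - 1) / (η * g * μ + k)
        = (k * μ + g * η) / (η * g * μ + k) := by
      field_simp; ring
    have h3 : 0 < k * μ + g * η := by positivity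
    rw [h2]
    field_simp
  have ratpos : 0 < η * g / k := by positivity
  have lIlog : Tendsto (fun μ => Real.logb 2
      (μ / (μ - g * η * (μ ^ 2 - 1) / VB g ω γ η μ) / μ)) atTop
      (nhds (Real.logb 2 (η * g / k))) := by
    simp only [Real.logb]
    exact (lI.log ratpos.ne').div_const _
  have key := ((lIlog.const_mul (1 / 2)).sub ((t1.add t2).sub (b1.add b2)))
  have elim : (1 / 2) * Real.logb 2 (η * g / k)
      - (((1 - Real.log 2) / Real.log 2 + (1 / 2) * Real.logb 2 ((g - 1) ^ 2)
          + h (√(((g - 1) * ω) ^ 2 / (g - 1) ^ 2)))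
        - ((1 - Real.log 2) / Real.log 2 + (1 / 2) * Real.logb 2 (A / (η * g) * (g - 1))
          + h (√((A / (η * g) * ω - (c / g) ^ 2) * ((g - 1) * ω) / (A / (η * g) * (g - 1))))))
      = Rrr g ω η γ := by
    have r1 : √(((g - 1) * ω) ^ 2 / (g - 1) ^ 2) = ω := by
      rw [show ((g - 1) * ω) ^ 2 / (g - 1) ^ 2 = ω ^ 2 by field_simp, Real.sqrt_sq hω0.le]
    have r2 : (A / (η * g) * ω - (c / g) ^ 2) * ((g - 1) * ω) / (A / (η * g) * (g - 1))
        = ω * (η + γ * ω * (g - 1) * (1 - η)) / A := by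
      rw [div_pow, c2]
      field_simp
      simp only [hA]
      ring
    have r3 : γ * (1 - η) + η * ω * (g - 1) = k := by simp only [hk]; ring
    rw [r1, r2]
    simp only [Rrr]
    rw [← hA, r3]
    have r4 : Real.logb 2 (A / ((g - 1) * k)) = Real.logb 2 (η * g / k)
        - Real.logb 2 ((g - 1) ^ 2) + Real.logb 2 (A / (η * g) * (g - 1)) := by
      rw [← Real.logb_div (by positivity) (by positivity),
        ← Real.logb_mul (by positivity) (by positivity)]
      congr 1
      field_simp
    rw [r4]
    ring
  rw [elim] at key
  refine key.congr' ?_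
  filter_upwards [eventually_gt_atTop 1, lI.eventually_const_lt ratpos] with μ hμ h1
  have hμ0 : 0 < μ := by linarith
  have h2 := (div_pos_iff_of_pos_right hμ0).1 h1
  rw [Real.logb_div h2.ne' hμ0.ne']
  simp only [nu1, nu2, Real.logb, Real.log_pow]
  push_cast
  ring
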